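/- Let X and Y be probabilistic coherence spaces and s ∈ (ℝ≥0)^{Mfin(|X|)×|Y|}. Then s ∈ P(!X⊸Y) if and only if for every u ∈ P(X) the family ŝ(u), defined by ŝ(u)_b = Σ_{m∈Mfin(|X|)} s_{m,b} u^m, belongs to P(Y). -/

import Mathlib

open scoped ENNReal NNReal Classical

noncomputable section

namespace PCS

variable {I J K : Type*}

/-- Pairing `⟨u,u'⟩ = Σ_a u_a u'_a`, valued in `[0,∞]`. -/
def pair (u u' : I → ℝ≥0) : ℝ≥0∞ := ∑' a, (u a : ℝ≥0∞) * (u' a : ℝ≥0∞)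

/-- Orthogonal of a set of nonnegative families. -/
def orth (F : Set (I → ℝ≥0)) : Set (I → ℝ≥0) := {u' | ∀ u ∈ F, pair u u' ≤ 1}

/-- `P` is (the set of vectors of) a probabilistic coherence space on the web `I`. -/
structure IsPCS (P : Set (I → ℝ≥0)) : Prop where
  biorth : orth (orth P) = P
  pos : ∀ a : I, ∃ u ∈ P, 0 < u a
  bdd : ∀ a : I, ∃ A : ℝ≥0, 0 < A ∧ ∀ u ∈ P, u a ≤ A

/-- Application of a matrix to a vector: `(t·u)_b = Σ_a t_{a,b} u_a ∈ [0,∞]`. -/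
def matApp (t : I × J → ℝ≥0) (u : I → ℝ≥0) : J → ℝ≥0∞ :=
  fun b => ∑' a, (t (a, b) : ℝ≥0∞) * (u a : ℝ≥0∞)

/-- Application for `[0,∞]`-valued matrices/vectors. -/
def matAppE (t : I × J → ℝ≥0∞) (u : I → ℝ≥0∞) : J → ℝ≥0∞ :=
  fun b => ∑' a, t (a, b) * u a

/-- A `[0,∞]`-valued vector belongs to `Q ⊆ (ℝ≥0)^J` if it is pointwise the coercion of
an element of `Q` (in particular it is everywhere finite). -/
def memP (Q : Set (J → ℝ≥0)) (v : J → ℝ≥0∞) : Prop :=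
  ∃ w ∈ Q, ∀ b, v b = (w b : ℝ≥0∞)

/-- `t` is a morphism from `(I,P)` to `(J,Q)`: `t·u ∈ Q` for every `u ∈ P`. -/
def IsMorphism (t : I × J → ℝ≥0) (P : Set (I → ℝ≥0)) (Q : Set (J → ℝ≥0)) : Prop :=
  ∀ u ∈ P, memP Q (matApp t u)

/-- Matrix composition `(t ∘ s)_{a,c} = Σ_b s_{a,b} t_{b,c}`, in `[0,∞]`. -/
def matComp (s : I × J → ℝ≥0) (t : J × K → ℝ≥0) : I × K → ℝ≥0∞ :=
  fun p => ∑' b, (s (p.1, b) : ℝ≥0∞) * (t (b, p.2) : ℝ≥0∞)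

/-- Composition of `[0,∞]`-valued matrices. -/
def matCompE (s : I × J → ℝ≥0∞) (t : J × K → ℝ≥0∞) : I × K → ℝ≥0∞ :=
  fun p => ∑' b, s (p.1, b) * t (b, p.2)

/-- Set of simple tensors `u⊗v` with `u ∈ P`, `v ∈ Q`. -/
def tensSet (P : Set (I → ℝ≥0)) (Q : Set (J → ℝ≥0)) : Set (I × J → ℝ≥0) :=
  {w | ∃ u ∈ P, ∃ v ∈ Q, w = fun p => u p.1 * v p.2}

/-- `P(X⊗Y)`: biorthogonal closure of the simple tensors. -/
def tensorP (P : Set (I → ℝ≥0)) (Q : Set (J → ℝ≥0)) : Set (I × J → ℝ≥0) :=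
  orth (orth (tensSet P Q))

/-- `P(X⊸Y) = P((X ⊗ Y⊥)⊥)`. -/
def limplP (P : Set (I → ℝ≥0)) (Q : Set (J → ℝ≥0)) : Set (I × J → ℝ≥0) :=
  orth (tensorP P (orth Q))

/-- Norm `‖u‖_X = sup{⟨u,u'⟩ : u' ∈ P(X)⊥}`. -/
def normE (P : Set (I → ℝ≥0)) (u : I → ℝ≥0) : ℝ≥0∞ :=
  ⨆ u' ∈ orth P, pair u u'

/-- The product `&_{i} X_i`. -/
def withP {ι : Type*} {A : ι → Type*} (P : ∀ i, Set (A i → ℝ≥0)) :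
    Set ((Σ i, A i) → ℝ≥0) :=
  {u | ∀ i, (fun a => u ⟨i, a⟩) ∈ P i}

/-- The coproduct `⊕_{i} X_i = (&_{i} X_i⊥)⊥`. -/
def plusP {ι : Type*} {A : ι → Type*} (P : ∀ i, Set (A i → ℝ≥0)) :
    Set ((Σ i, A i) → ℝ≥0) :=
  orth (withP fun i => orth (P i))

/-- Projection matrix `π_i`. -/
def projMat {ι : Type*} {A : ι → Type*} (i : ι) : ((Σ j, A j) × A i) → ℝ≥0 :=
  fun p => if p.1 = ⟨i, p.2⟩ then 1 else 0

/-- Injection matrix `in_j`. -/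
def injMat {ι : Type*} {A : ι → Type*} (j : ι) : (A j × Σ i, A i) → ℝ≥0 :=
  fun p => if p.2 = ⟨j, p.1⟩ then 1 else 0

/-- `u^m = Π_a u_a^{m(a)}`. -/
def mpow (u : I → ℝ≥0) (m : Multiset I) : ℝ≥0 := (m.map u).prod

/-- `v^m` for `[0,∞]`-valued `v`. -/
def mpowE (v : I → ℝ≥0∞) (m : Multiset I) : ℝ≥0∞ := (m.map v).prod

/-- Promotion `u^! = (u^m)_m`. -/
def promote (u : I → ℝ≥0) : Multiset I → ℝ≥0 := fun m => mpow u m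

/-- `P(!X)`: biorthogonal closure of the promotions. -/
def bangP (P : Set (I → ℝ≥0)) : Set (Multiset I → ℝ≥0) :=
  orth (orth {v | ∃ u ∈ P, v = promote u})

/-- The function associated with a matrix `s ∈ (ℝ≥0)^{Mfin(I)×J}`:
`ŝ(u)_b = Σ_m s_{m,b} u^m`. -/
def fhat (s : Multiset I × J → ℝ≥0) (u : I → ℝ≥0) : J → ℝ≥0∞ :=
  fun b => ∑' m : Multiset I, (s (m, b) : ℝ≥0∞) * (mpow u m : ℝ≥0∞)

/-- Factorial of a multiset: `m! = Π_a m(a)!`. -/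
def mfact [DecidableEq I] (m : Multiset I) : ℕ :=
  (m.dedup.map fun a => (m.count a).factorial).prod

/-- Multisets over `I × J` with first marginal `c` and second marginal `d`. -/
def marg (c : Multiset I) (d : Multiset J) : Set (Multiset (I × J)) :=
  {r | r.map Prod.fst = c ∧ r.map Prod.snd = d}

/-- The exponential of a matrix: `(!t)_{c,d} = Σ_{r ∈ L(c,d)} (d!/r!) t^r`. -/
def bangMatE [DecidableEq I] [DecidableEq J] (t : I × J → ℝ≥0∞) :
    Multiset I × Multiset J → ℝ≥0∞ :=
  fun p => ∑' r : marg p.1 p.2,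
    ((mfact p.2 : ℝ≥0∞) / (mfact r.1 : ℝ≥0∞)) * mpowE t r.1

theorem pair_comm (u v : I → ℝ≥0) : pair u v = pair v u := by
  simp only [pair, mul_comm]

theorem subset_orth_orth (F : Set (I → ℝ≥0)) : F ⊆ orth (orth F) := by
  intro u hu v hv
  rw [pair_comm]
  exact hv u hu

theorem orth_anti {F G : Set (I → ℝ≥0)} (h : F ⊆ G) : orth G ⊆ orth F :=
  fun _ hv u hu => hv u (h hu)

theorem orth_orth_orth (F : Set (I → ℝ≥0)) : orth (orth (orth F)) = orth F :=
  (orth_anti (subset_orth_orth F)).antisymm (subset_orth_orth (orth F))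

/-- A web element on which `P` is bounded is charged by some vector of `orth P`. -/
theorem exists_mem_orth_pos {P : Set (I → ℝ≥0)} {a : I} {A : ℝ≥0} (hA : 0 < A)
    (h : ∀ u ∈ P, u a ≤ A) : ∃ q ∈ orth P, 0 < q a := by
  refine ⟨Pi.single a A⁻¹, fun u hu => ?_, by simpa using hA⟩
  rw [pair, tsum_eq_single a fun b hb => by simp [Pi.single_eq_of_ne hb], Pi.single_eq_same,
    ← ENNReal.coe_mul, ← ENNReal.coe_one, ENNReal.coe_le_coe, ← div_eq_mul_inv]
  exact div_le_one_of_le₀ (h u hu) zero_le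

theorem pair_tensor (v : I → ℝ≥0) (q : J → ℝ≥0) (s : I × J → ℝ≥0) :
    pair (fun p => v p.1 * q p.2) s = ∑' b, (q b : ℝ≥0∞) * matApp s v b := by
  rw [pair, ENNReal.tsum_prod', ENNReal.tsum_comm]
  refine tsum_congr fun b => ?_
  rw [matApp, ← ENNReal.tsum_mul_left]
  refine tsum_congr fun a => ?_
  push_cast
  ring

theorem mem_limplP_iff {P : Set (I → ℝ≥0)} {Q : Set (J → ℝ≥0)} {s : I × J → ℝ≥0} :
    s ∈ limplP P Q ↔
      ∀ v ∈ P, ∀ q ∈ orth Q, ∑' b, (q b : ℝ≥0∞) * matApp s v b ≤ 1 := by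
  rw [limplP, tensorP, orth_orth_orth]
  constructor
  · intro h v hv q hq
    rw [← pair_tensor]
    exact h _ ⟨v, hv, q, hq, rfl⟩
  · rintro h _ ⟨v, hv, q, hq, rfl⟩
    rw [pair_tensor]
    exact h v hv q hq

/-- Testing a matrix on the biorthogonal of `F` reduces to testing it on `F`. -/
theorem tsum_matApp_le_one_of_mem_orth_orth {F : Set (I → ℝ≥0)} {s : I × J → ℝ≥0}
    {q : J → ℝ≥0} (h : ∀ v ∈ F, ∑' b, (q b : ℝ≥0∞) * matApp s v b ≤ 1)
    {v : I → ℝ≥0} (hv : v ∈ orth (orth F)) :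
    ∑' b, (q b : ℝ≥0∞) * matApp s v b ≤ 1 := by
  have key (B : Finset J) (w : I → ℝ≥0) :
      pair (fun a => ∑ b ∈ B, q b * s (a, b)) w = ∑ b ∈ B, (q b : ℝ≥0∞) * matApp s w b := by
    simp only [pair, matApp, ← ENNReal.tsum_mul_left]
    rw [← Summable.tsum_finsetSum fun _ _ => ENNReal.summable]
    refine tsum_congr fun a => ?_
    push_cast
    rw [Finset.sum_mul]
    exact Finset.sum_congr rfl fun b _ => mul_assoc _ _ _
  rw [ENNReal.tsum_eq_iSup_sum]
  refine iSup_le fun B => ?_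
  rw [← key]
  refine hv _ fun w hw => ?_
  rw [pair_comm, key]
  exact (ENNReal.sum_le_tsum B).trans (h w hw)

/-- A `[0,∞]`-valued vector belongs to a PCS iff it pairs to at most `1` with its dual. -/
theorem memP_iff {Q : Set (J → ℝ≥0)} (hQ : IsPCS Q) {x : J → ℝ≥0∞} :
    memP Q x ↔ ∀ q ∈ orth Q, ∑' b, (q b : ℝ≥0∞) * x b ≤ 1 := by
  constructor
  · rintro ⟨w, hw, hx⟩ q hq
    simp only [hx]
    exact (pair_comm q w).trans_le (hq w hw)
  · intro h
    have hfin (b : J) : x b ≠ ∞ := by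
      obtain ⟨A, hA, hb⟩ := hQ.bdd b
      obtain ⟨q, hq, hpos⟩ := exists_mem_orth_pos hA hb
      intro hx
      have hle := (ENNReal.le_tsum b).trans (h q hq)
      rw [hx, ENNReal.mul_top (by exact_mod_cast hpos.ne')] at hle
      exact absurd hle (by simp)
    refine ⟨fun b => (x b).toNNReal, ?_, fun b => (ENNReal.coe_toNNReal (hfin b)).symm⟩
    rw [← hQ.biorth]
    intro q hq
    simpa only [pair, ENNReal.coe_toNNReal (hfin _)] using h q hq

/-- Theorem 3.9: `s ∈ P(!X⊸Y)` iff the associated power series `ŝ` maps `P(X)` into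
`P(Y)`. -/
theorem kleisli_charact {I J : Type*} [Countable I] [Countable J]
    (P : Set (I → ℝ≥0)) (Q : Set (J → ℝ≥0)) (hP : IsPCS P) (hQ : IsPCS Q)
    (s : Multiset I × J → ℝ≥0) :
    s ∈ limplP (bangP P) Q ↔ ∀ u ∈ P, memP Q (fhat s u) := by
  simp only [mem_limplP_iff, memP_iff hQ]
  constructor
  · intro h u hu
    exact h (promote u) (subset_orth_orth _ ⟨u, hu, rfl⟩)
  · intro h v hv q hq
    refine tsum_matApp_le_one_of_mem_orth_orth ?_ hv
    rintro _ ⟨u, hu, rfl⟩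
    exact h u hu q hq

end PCS
end
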